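/- arXiv:2502.01409 — 2 statements merged into one kernel-verified Lean document; each statement's English description precedes it below -/
import Mathlib

section
/- The set {3, 4, 6, 11, 12, 22, 33} is the unique 1-partition of 91; that is, it is the only set of distinct positive integers summing to 91 whose reciprocals sum to 1. -/
/-- Least common multiple of `1, ..., 91`. -/
def bigL : ℕ := 718766754945489455304472257065075294400

/-- Entries `(a, bigL / a, g)`, where `g` divides the second component of this and all later
entries. The candidates are ordered by their largest prime factors. -/
def table : List (ℕ × ℕ × ℕ) :=
  [(89, 8076030954443701744994070304101969600, 1),
   (83, 8659840421029993437403280205603316800, 89),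
   (79, 9098313353740372851955345026140193600, 7387),
   (73, 9846119930760129524718798041987332800, 583573),
   (71, 10123475421767457116964397986832046400, 42600829),
   (67, 10727862014111782914992123239777243200, 3024658859),
   (61, 11783061556483433693515938640411070400, 202652143553),
   (59, 12182487371957448394991055204492801600, 12361780756733),
   (53, 13561636885763951986876835038963684800, 729345064647247),
   (47, 15292909679691265006478133129044155200, 38655288426304091),
   (86, 8357752964482435526796189035640410400, 1816798556036292277),
   (43, 16715505928964871053592378071280820800, 1816798556036292277),
   (82, 8765448231042554332981368988598479200, 78122337909560567911),
   (41, 17530896462085108665962737977196958400, 78122337909560567911),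
   (74, 9713064256020127774384760230609125600, 3203015854291983284351),
   (37, 19426128512040255548769520461218251200, 3203015854291983284351),
   (62, 11593012176540152504910842855888311200, 118511586608803381520987),
   (31, 23186024353080305009821685711776622400, 118511586608803381520987),
   (87, 8261686838453901785108876517989371200, 3673859184872904827150597),
   (58, 12392530257680852677663314776984056800, 3673859184872904827150597),
   (29, 24785060515361705355326629553968113600, 3673859184872904827150597),
   (69, 10416909491963615294267713870508337600, 106541916361314239987367313),
   (46, 15625364237945422941401570805762506400, 106541916361314239987367313),
   (23, 31250728475890845882803141611525012800, 106541916361314239987367313),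
   (76, 9457457301914334938216740224540464400, 2450464076310227519709448199),
   (57, 12609943069219113250955653632720619200, 2450464076310227519709448199),
   (38, 18914914603828669876433480449080928800, 2450464076310227519709448199),
   (19, 37829829207657339752866960898161857600, 2450464076310227519709448199),
   (85, 8456079469946934768287908906647944640, 46558817449894322874479515781),
   (68, 10570099337433668460359886133309930800, 46558817449894322874479515781),
   (51, 14093465783244891280479848177746574400, 46558817449894322874479515781),
   (34, 21140198674867336920719772266619861600, 46558817449894322874479515781),
   (17, 42280397349734673841439544533239723200, 46558817449894322874479515781),
   (91, 7898535768631752256093101725989838400, 791499896648203488866151768277),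
   (78, 9214958396737044298775285346988144800, 791499896648203488866151768277),
   (65, 11057950076084453158530342416385773760, 791499896648203488866151768277),
   (52, 13822437595105566448162928020482217200, 791499896648203488866151768277),
   (39, 18429916793474088597550570693976289600, 791499896648203488866151768277),
   (26, 27644875190211132896325856040964434400, 791499896648203488866151768277),
   (13, 55289750380422265792651712081928868800, 791499896648203488866151768277),
   (88, 8167804033471471083005366557557673800, 10289498656426645355259972987601),
   (77, 9334633181110252666291847494351627200, 10289498656426645355259972987601),
   (66, 10890405377961961444007155410076898400, 10289498656426645355259972987601),
   (55, 13068486453554353732808586492092278080, 10289498656426645355259972987601),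
   (44, 16335608066942942166010733115115347600, 10289498656426645355259972987601),
   (33, 21780810755923922888014310820153796800, 10289498656426645355259972987601),
   (22, 32671216133885884332021466230230695200, 10289498656426645355259972987601),
   (11, 65342432267771768664042932460461390400, 10289498656426645355259972987601),
   (49, 14668709284601825618458617491123985600, 113184485220693098907859702863611),
   (84, 8556747082684398277434193536488991600, 792291396544851692355017920045277),
   (70, 10268096499221277932921032243786789920, 792291396544851692355017920045277),
   (63, 11408996110245864369912258048651988800, 792291396544851692355017920045277),
   (56, 12835120624026597416151290304733487400, 792291396544851692355017920045277),
   (42, 17113494165368796554868387072977983200, 792291396544851692355017920045277),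
   (35, 20536192998442555865842064487573579840, 792291396544851692355017920045277),
   (28, 25670241248053194832302580609466974800, 792291396544851692355017920045277),
   (21, 34226988330737593109736774145955966400, 792291396544851692355017920045277),
   (14, 51340482496106389664605161218933949600, 792291396544851692355017920045277),
   (7, 102680964992212779329210322437867899200, 792291396544851692355017920045277),
   (75, 9583556732606526070726296760867670592, 5546039775813961846485125440316939),
   (50, 14375335098909789106089445141301505888, 5546039775813961846485125440316939),
   (25, 28750670197819578212178890282603011776, 5546039775813961846485125440316939),
   (90, 7986297277172105058938580634056392160, 27730198879069809232425627201584695),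
   (80, 8984584436818618191305903213313441180, 27730198879069809232425627201584695),
   (60, 11979445915758157588407870951084588240, 27730198879069809232425627201584695),
   (45, 15972594554344210117877161268112784320, 27730198879069809232425627201584695),
   (40, 17969168873637236382611806426626882360, 27730198879069809232425627201584695),
   (30, 23958891831516315176815741902169176480, 27730198879069809232425627201584695),
   (20, 35938337747274472765223612853253764720, 27730198879069809232425627201584695),
   (15, 47917783663032630353631483804338352960, 27730198879069809232425627201584695),
   (10, 71876675494548945530447225706507529440, 27730198879069809232425627201584695),
   (5, 143753350989097891060894451413015058880, 27730198879069809232425627201584695),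
   (81, 8873663641302338954376200704507102400, 138650994395349046162128136007923475),
   (54, 13310495461953508431564301056760653600, 415952983186047138486384408023770425),
   (27, 26620990923907016863128602113521307200, 415952983186047138486384408023770425),
   (72, 9982871596465131323673225792570490200, 1247858949558141415459153224071311275),
   (36, 19965743192930262647346451585140980400, 1247858949558141415459153224071311275),
   (18, 39931486385860525294692903170281960800, 1247858949558141415459153224071311275),
   (9, 79862972771721050589385806340563921600, 1247858949558141415459153224071311275),
   (48, 14974307394697696985509838688855735300, 3743576848674424246377459672213933825),
   (24, 29948614789395393971019677377711470600, 3743576848674424246377459672213933825),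
   (12, 59897229578790787942039354755422941200, 3743576848674424246377459672213933825),
   (6, 119794459157581575884078709510845882400, 3743576848674424246377459672213933825),
   (3, 239588918315163151768157419021691764800, 3743576848674424246377459672213933825),
   (64, 11230730546023272739132379016641801475, 11230730546023272739132379016641801475),
   (32, 22461461092046545478264758033283602950, 22461461092046545478264758033283602950),
   (16, 44922922184093090956529516066567205900, 44922922184093090956529516066567205900),
   (8, 89845844368186181913059032133134411800, 89845844368186181913059032133134411800),
   (4, 179691688736372363826118064266268823600, 179691688736372363826118064266268823600),
   (2, 359383377472744727652236128532537647200, 359383377472744727652236128532537647200),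
   (1, 718766754945489455304472257065075294400, 718766754945489455304472257065075294400)]

/-- The invariants of the table. -/
def validTable : List (ℕ × ℕ × ℕ) → Bool
  | [] => true
  | e :: t => (bigL / e.1 == e.2.1) && (e.2.1 % e.2.2 == 0) &&
      t.all (fun x => x.2.1 % e.2.2 == 0) && validTable t

/-- All ways to write `s` as a sum of candidates with weights adding up to `R`. -/
def search : List (ℕ × ℕ × ℕ) → ℕ → ℕ → List (List ℕ)
  | [], s, R => bif Nat.beq s 0 && Nat.beq R 0 then [[]] else []
  | e :: t, s, R =>
    bif Nat.beq (R % e.2.2) 0 then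
      (bif Nat.ble e.1 s && Nat.ble e.2.1 R then
        (search t (s - e.1) (R - e.2.1)).map (List.cons e.1) else []) ++ search t s R
    else []

theorem search_complete : ∀ (l : List (ℕ × ℕ × ℕ)), validTable l = true →
    ∀ (A : Finset ℕ), (∀ a ∈ A, ∃ e ∈ l, e.1 = a) →
    ∃ B ∈ search l (∑ a ∈ A, a) (∑ a ∈ A, bigL / a), B.toFinset = A := by
  intro l
  induction l with
  | nil =>
    intro _ A hA
    have : A = ∅ := by
      apply Finset.eq_empty_of_forall_notMem
      intro a ha
      obtain ⟨e, he, _⟩ := hA a ha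
      simp at he
    subst this
    simp [search]
  | cons e t ih =>
    intro hv A hA
    simp only [validTable, Bool.and_eq_true, beq_iff_eq, List.all_eq_true] at hv
    obtain ⟨⟨⟨h1, h2⟩, h3⟩, h4⟩ := hv
    have hw : ∀ (t : List (ℕ × ℕ × ℕ)), validTable t = true → ∀ x ∈ t, bigL / x.1 = x.2.1 := by
      intro t
      induction t with
      | nil => simp
      | cons y t ih =>
        intro hv x hx
        simp only [validTable, Bool.and_eq_true, beq_iff_eq] at hv
        rcases List.mem_cons.1 hx with rfl | hx
        · exact hv.1.1.1
        · exact ih hv.2 x hx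
    have hdvd : (∑ a ∈ A, bigL / a) % e.2.2 = 0 := by
      apply Nat.mod_eq_zero_of_dvd
      apply Finset.dvd_sum
      intro a ha
      obtain ⟨x, hx, rfl⟩ := hA a ha
      rcases List.mem_cons.1 hx with rfl | hx
      · rw [h1]; exact Nat.dvd_of_mod_eq_zero h2
      · rw [hw t h4 x hx]; exact Nat.dvd_of_mod_eq_zero (h3 x hx)
    simp only [search, hdvd, Nat.beq_refl, cond_true, List.mem_append]
    by_cases hm : e.1 ∈ A
    · have hs := Finset.add_sum_erase A (fun a => a) hm
      have hr := Finset.add_sum_erase A (fun a => bigL / a) hm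
      simp only [h1] at hs hr
      obtain ⟨B, hB, hBA⟩ := ih h4 (A.erase e.1) (by
        intro a ha
        rw [Finset.mem_erase] at ha
        obtain ⟨x, hx, rfl⟩ := hA a ha.2
        rcases List.mem_cons.1 hx with rfl | hx
        · exact absurd rfl ha.1
        · exact ⟨x, hx, rfl⟩)
      refine ⟨e.1 :: B, Or.inl ?_, ?_⟩
      · have c1 : Nat.ble e.1 (∑ a ∈ A, a) = true := Nat.ble_eq_true_of_le (by omega)
        have c2 : Nat.ble e.2.1 (∑ a ∈ A, bigL / a) = true := Nat.ble_eq_true_of_le (by omega)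
        rw [c1, c2, ← hs, ← hr, Nat.add_sub_cancel_left, Nat.add_sub_cancel_left]
        exact List.mem_map.2 ⟨B, hB, rfl⟩
      · rw [List.toFinset_cons, hBA, Finset.insert_erase hm]
    · obtain ⟨B, hB, hBA⟩ := ih h4 A (by
        intro a ha
        obtain ⟨x, hx, rfl⟩ := hA a ha
        rcases List.mem_cons.1 hx with rfl | hx
        · exact absurd ha hm
        · exact ⟨x, hx, rfl⟩)
      exact ⟨B, Or.inr hB, hBA⟩

theorem table_valid : validTable table = true := by decide +kernel

theorem table_covers : ∀ a < 92, 0 < a → (∃ e ∈ table, e.1 = a) ∧ a ∣ bigL := by decide +kernel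

theorem search_result : search table 91 bigL = [[33, 22, 11, 12, 6, 3, 4]] := by decide +kernel

theorem unique_one_partition_of_91 :
    ((∀ a ∈ ({3, 4, 6, 11, 12, 22, 33} : Finset ℕ), 0 < a) ∧
      (∑ a ∈ ({3, 4, 6, 11, 12, 22, 33} : Finset ℕ), a = 91) ∧
      (∑ a ∈ ({3, 4, 6, 11, 12, 22, 33} : Finset ℕ), (1 : ℚ) / a = 1)) ∧
    (∀ A : Finset ℕ, (∀ a ∈ A, 0 < a) → (∑ a ∈ A, a = 91) →
      (∑ a ∈ A, (1 : ℚ) / a = 1) →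
      A = ({3, 4, 6, 11, 12, 22, 33} : Finset ℕ)) := by
  refine ⟨⟨by decide, by decide, ?_⟩, ?_⟩
  · norm_num [Finset.sum_insert]
  · intro A hpos hsum hrec
    have hlt : ∀ a ∈ A, a < 92 := by
      intro a ha
      have := Finset.single_le_sum (f := fun a : ℕ => a) (fun _ _ => Nat.zero_le _) ha
      simp only [hsum] at this
      omega
    have hR : ∑ a ∈ A, bigL / a = bigL := by
      have h : ((∑ a ∈ A, bigL / a : ℕ) : ℚ) = (bigL : ℚ) := by
        calc ((∑ a ∈ A, bigL / a : ℕ) : ℚ) = ∑ a ∈ A, (bigL : ℚ) * (1 / a) := by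
              rw [Nat.cast_sum]
              refine Finset.sum_congr rfl fun a ha => ?_
              rw [Nat.cast_div (table_covers a (hlt a ha) (hpos a ha)).2
                (by exact_mod_cast (hpos a ha).ne')]
              ring
          _ = bigL := by rw [← Finset.mul_sum, hrec, mul_one]
      exact_mod_cast h
    obtain ⟨B, hB, hBA⟩ := search_complete table table_valid A
      (fun a ha => (table_covers a (hlt a ha) (hpos a ha)).1)
    rw [hsum, hR, search_result, List.mem_singleton] at hB
    rw [← hBA, hB]
    decide
end

section
/- The set {2, 4, 10, 15, 21, 28} is the unique 1-partition of 80. -/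
/-!
Every member of a 1-partition of 80 lies in `1..80`.  Multiplying reciprocals by `L = lcm(1..80)`
turns the problem into an exhaustive search over subsets, pruned by divisibility: the remaining
weight must be divisible by a common divisor of the weights that are still available.  Candidates
are ordered by largest prime power factor, so the search visits fewer than 2000 nodes.
-/

namespace OnePartition80

/-- The least common multiple of `1..80`. -/
def bigL : ℕ := 32433859254793982911622772305630400

/-- The claimed solution, as a Boolean predicate. -/
def tgt (a : ℕ) : Bool :=
  Nat.beq a 2 || Nat.beq a 4 || Nat.beq a 10 || Nat.beq a 15 || Nat.beq a 21 || Nat.beq a 28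

/-- Candidates, each with a common divisor of the weights `bigL / b` from that point on. -/
def cands : List (ℕ × ℕ) :=
  [(79, 1), (73, 79), (71, 5767), (67, 409457), (64, 27433619), (61, 54867238), (59,
   3346901518), (53, 197467189562), (49, 10465761046786), (47, 73260327327502), (43,
   3443235384392594), (41, 148059121528881542), (74, 6070423982684143222), (37,
   6070423982684143222), (32, 224605687359313299214), (62, 449211374718626598428), (31,
   449211374718626598428), (58, 13925552616277424551268), (29, 13925552616277424551268), (54,
   403841025872045311986772), (27, 403841025872045311986772), (75, 1211523077616135935960316),
   (50, 1211523077616135935960316), (25, 1211523077616135935960316), (69,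
   6057615388080679679801580), (46, 6057615388080679679801580), (23,
   6057615388080679679801580), (76, 139325153925855632635436340), (57,
   139325153925855632635436340), (38, 139325153925855632635436340), (19,
   139325153925855632635436340), (68, 2647177924591257020073290460), (51,
   2647177924591257020073290460), (34, 2647177924591257020073290460), (17,
   2647177924591257020073290460), (80, 45002024718051369341245937820), (48,
   45002024718051369341245937820), (16, 45002024718051369341245937820), (78,
   90004049436102738682491875640), (65, 90004049436102738682491875640), (52,
   90004049436102738682491875640), (39, 90004049436102738682491875640), (26,
   90004049436102738682491875640), (13, 90004049436102738682491875640), (77,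
   1170052642669335602872394383320), (66, 1170052642669335602872394383320), (55,
   1170052642669335602872394383320), (44, 1170052642669335602872394383320), (33,
   1170052642669335602872394383320), (22, 1170052642669335602872394383320), (11,
   1170052642669335602872394383320), (72, 12870579069362691631596338216520), (63,
   12870579069362691631596338216520), (45, 12870579069362691631596338216520), (36,
   12870579069362691631596338216520), (18, 12870579069362691631596338216520), (9,
   12870579069362691631596338216520), (56, 38611737208088074894789014649560), (40,
   38611737208088074894789014649560), (24, 38611737208088074894789014649560), (8,
   38611737208088074894789014649560), (70, 77223474416176149789578029299120), (42,
   77223474416176149789578029299120), (35, 77223474416176149789578029299120), (28,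
   77223474416176149789578029299120), (21, 77223474416176149789578029299120), (14,
   77223474416176149789578029299120), (7, 77223474416176149789578029299120), (60,
   540564320913233048527046205093840), (30, 540564320913233048527046205093840), (20,
   540564320913233048527046205093840), (15, 540564320913233048527046205093840), (10,
   540564320913233048527046205093840), (5, 540564320913233048527046205093840), (12,
   2702821604566165242635231025469200), (4, 2702821604566165242635231025469200), (6,
   5405643209132330485270462050938400), (3, 5405643209132330485270462050938400), (2,
   16216929627396991455811386152815200), (1, 32433859254793982911622772305630400)]

/-- The divisor annotations are correct. -/
def valid : List (ℕ × ℕ) → Bool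
  | [] => true
  | (a, g) :: t =>
    Nat.beq (bigL / a % g) 0 && t.all (fun x => Nat.beq (bigL / x.1 % g) 0) && valid t

/-- `search l s w b`: any choice from `l` with sum `s` and weight `w` agrees with `tgt`
(and `b` holds). -/
def search : List (ℕ × ℕ) → ℕ → ℕ → Bool → Bool
  | [], s, w, b => !(Nat.beq s 0) || !(Nat.beq w 0) || b
  | (a, g) :: t, s, w, b =>
    !(Nat.beq (w % g) 0) ||
      (search t s w (b && !(tgt a)) &&
        (!(Nat.ble a s) || !(Nat.ble (bigL / a) w) ||
          search t (s - a) (w - bigL / a) (b && tgt a)))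

/-- Sum of `f` over the chosen entries. -/
def total (f : ℕ → ℕ) (P : ℕ → Bool) : List (ℕ × ℕ) → ℕ
  | [] => 0
  | x :: t => (if P x.1 = true then f x.1 else 0) + total f P t

theorem dvd_total (g : ℕ) (P : ℕ → Bool) (l : List (ℕ × ℕ))
    (h : ∀ x ∈ l, g ∣ bigL / x.1) : g ∣ total (fun a => bigL / a) P l := by
  induction l with
  | nil => simp [total]
  | cons x t ih =>
    simp only [total]
    refine dvd_add ?_ (ih fun y hy => h y (List.mem_cons_of_mem _ hy))
    split
    · exact h x List.mem_cons_self
    · exact dvd_zero _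

theorem search_sound (P : ℕ → Bool) (l : List (ℕ × ℕ)) (hv : valid l = true) :
    ∀ (s w : ℕ) (b : Bool), search l s w b = true → total (fun a => a) P l = s →
      total (fun a => bigL / a) P l = w → b = true ∧ ∀ x ∈ l, P x.1 = tgt x.1 := by
  induction l with
  | nil =>
    intro s w b h hs hw
    simp only [total] at hs hw
    subst hs hw
    simpa [search] using h
  | cons x t ih =>
    obtain ⟨a, g⟩ := x
    intro s w b h hs hw
    simp only [valid, Bool.and_eq_true, List.all_eq_true, Nat.beq_eq] at hv
    obtain ⟨⟨hv1, hv2⟩, hv3⟩ := hv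
    have hg : w % g = 0 := by
      rw [← hw]
      apply Nat.mod_eq_zero_of_dvd
      apply dvd_total
      intro y hy
      rcases List.mem_cons.1 hy with rfl | hy
      · exact Nat.dvd_of_mod_eq_zero hv1
      · exact Nat.dvd_of_mod_eq_zero (hv2 y hy)
    rw [search, hg] at h
    simp only [show Nat.beq 0 0 = true from rfl, Bool.not_true, Bool.false_or, Bool.and_eq_true] at h
    obtain ⟨h1, h2⟩ := h
    simp only [total] at hs hw
    cases hP : P a with
    | false =>
      simp only [hP, Bool.false_eq_true, if_false, zero_add] at hs hw
      obtain ⟨hb, ht⟩ := ih hv3 _ _ _ h1 hs hw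
      simp only [Bool.and_eq_true, Bool.not_eq_true'] at hb
      refine ⟨hb.1, fun y hy => ?_⟩
      rcases List.mem_cons.1 hy with rfl | hy
      · simp [hP, hb.2]
      · exact ht y hy
    | true =>
      simp only [hP, if_true] at hs hw
      have e1 : Nat.ble a s = true := Nat.ble_eq_true_of_le (by omega)
      have e2 : Nat.ble (bigL / a) w = true := Nat.ble_eq_true_of_le (by omega)
      rw [e1, e2] at h2
      simp only [Bool.not_true, Bool.false_or] at h2
      obtain ⟨hb, ht⟩ := ih hv3 _ _ _ h2 (by omega) (by omega)
      simp only [Bool.and_eq_true] at hb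
      refine ⟨hb.1, fun y hy => ?_⟩
      rcases List.mem_cons.1 hy with rfl | hy
      · simp [hP, hb.2]
      · exact ht y hy

theorem valid_cands : valid cands = true := by decide +kernel

theorem search_cands : search cands 80 bigL true = true := by decide +kernel

theorem total_eq (f : ℕ → ℕ) (P : ℕ → Bool) (l : List (ℕ × ℕ)) :
    total f P l = ((l.map Prod.fst).map (fun a => if P a = true then f a else 0)).sum := by
  induction l with
  | nil => rfl
  | cons x t ih => simp [total, ih]

theorem cands_nodup : (cands.map Prod.fst).Nodup := by decide +kernel

theorem cands_toFinset : (cands.map Prod.fst).toFinset = Finset.Icc 1 80 := by decide +kernel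

theorem bigL_dvd : ∀ a ∈ Finset.Icc 1 80, a ∣ bigL := by decide +kernel

theorem total_finset (f : ℕ → ℕ) (A : Finset ℕ) (hA : A ⊆ Finset.Icc 1 80) :
    total f (fun a => decide (a ∈ A)) cands = ∑ a ∈ A, f a := by
  rw [total_eq, ← List.sum_toFinset _ cands_nodup, cands_toFinset]
  simp only [decide_eq_true_eq]
  rw [← Finset.sum_filter, Finset.filter_mem_eq_inter, Finset.inter_eq_right.2 hA]

theorem uniqueness (A : Finset ℕ) (hpos : ∀ a ∈ A, 0 < a) (hsum : ∑ a ∈ A, a = 80)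
    (hrec : ∑ a ∈ A, (1 : ℚ) / a = 1) : A = {2, 4, 10, 15, 21, 28} := by
  have hA : A ⊆ Finset.Icc 1 80 := by
    intro a ha
    have := Finset.single_le_sum (f := fun a : ℕ => a) (fun i _ => Nat.zero_le i) ha
    exact Finset.mem_Icc.2 ⟨hpos a ha, by simpa [hsum] using this⟩
  have hw : ∑ a ∈ A, bigL / a = bigL := by
    have : ((∑ a ∈ A, bigL / a : ℕ) : ℚ) = bigL := by
      rw [Nat.cast_sum]
      calc ∑ a ∈ A, ((bigL / a : ℕ) : ℚ) = ∑ a ∈ A, (bigL : ℚ) * (1 / a) := by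
            refine Finset.sum_congr rfl fun a ha => ?_
            have h0 : (a : ℚ) ≠ 0 := by exact_mod_cast (hpos a ha).ne'
            rw [Nat.cast_div (bigL_dvd a (hA ha)) h0, mul_one_div]
        _ = bigL := by rw [← Finset.mul_sum, hrec, mul_one]
    exact_mod_cast this
  have key := (search_sound (fun a => decide (a ∈ A)) cands valid_cands 80 bigL true search_cands
    ((total_finset _ A hA).trans hsum) ((total_finset _ A hA).trans hw)).2
  have key2 : ∀ a ∈ Finset.Icc 1 80, decide (a ∈ A) = tgt a := by
    intro a ha
    rw [← cands_toFinset, List.mem_toFinset, List.mem_map] at ha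
    obtain ⟨x, hx, rfl⟩ := ha
    exact key x hx
  have htgt : ∀ a, tgt a = true ↔ a ∈ ({2, 4, 10, 15, 21, 28} : Finset ℕ) := by
    intro a
    simp [tgt, or_assoc]
  ext a
  rw [← htgt]
  constructor
  · intro ha
    rw [← key2 a (hA ha)]
    simpa using ha
  · intro ha
    have hm : a ∈ Finset.Icc 1 80 := by
      have := (htgt a).1 ha
      simp only [Finset.mem_insert, Finset.mem_singleton] at this
      rw [Finset.mem_Icc]
      omega
    rw [← key2 a hm] at ha
    simpa using ha

end OnePartition80

theorem unique_one_partition_of_80 :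
    ((∀ a ∈ ({2, 4, 10, 15, 21, 28} : Finset ℕ), 0 < a) ∧
      (∑ a ∈ ({2, 4, 10, 15, 21, 28} : Finset ℕ), a = 80) ∧
      (∑ a ∈ ({2, 4, 10, 15, 21, 28} : Finset ℕ), (1 : ℚ) / a = 1)) ∧
    (∀ A : Finset ℕ, (∀ a ∈ A, 0 < a) → (∑ a ∈ A, a = 80) →
      (∑ a ∈ A, (1 : ℚ) / a = 1) →
      A = ({2, 4, 10, 15, 21, 28} : Finset ℕ)) := by
  refine ⟨⟨by decide, by decide, by norm_num⟩, OnePartition80.uniqueness⟩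
end
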